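/- Let V be a finite set of n nodes, each node v carrying a feature vector x_v ∈ ℝ^d and a sensitive value s_v in a finite set 𝒜. For each a ∈ 𝒜 let V_a = {v : s_v = a} and V_{≠a} = V \ V_a, and assume each V_a and V_{≠a} is nonempty. Let Ã ∈ ℝ^{n×n} have nonnegative entries with each row summing to 1, set h_v = Σ_{u∈V} Ã[v,u] x_u, let W ∈ ℝ^{d×c} have spectral norm ‖W‖₂, and set p_v = Wᵀ h_v. Suppose the graph structure is balanced, i.e., for every a ∈ 𝒜, β[a,a] = β[≠a,a], where β[a,a] = (1/|V_a|) Σ_{i∈V_a, j∈V_a} Ã[i,j] and β[≠a,a] = (1/|V_{≠a}|) Σ_{i∈V_{≠a}, j∈V_a} Ã[i,j]. Then the demographic parity regularizer L̂_dp = Σ_{a∈𝒜} ‖ (1/|V_a|) Σ_{v∈V_a} p_v − (1/|V_{≠a}|) Σ_{v∈V_{≠a}} p_v ‖₂ satisfies L̂_dp ≤ 2√d · ‖W‖₂ · Σ_{a∈𝒜} δ_a, where δ_a = max( max_{v∈V_a} ‖x_v − μ_a‖_∞ , max_{v∈V_{≠a}} ‖x_v − μ_{≠a}‖_∞ ) and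 μ_a, μ_{≠a} are the means of the feature vectors over V_a and V_{≠a}. -/

import Mathlib

open Finset

/-- The Euclidean (ℓ²) norm of a vector in ℝ^d. -/
noncomputable def norm2 {d : ℕ} (v : Fin d → ℝ) : ℝ :=
  Real.sqrt (∑ i, v i ^ 2)

/-- The sup (ℓ^∞) norm of a vector in ℝ^d (the `Pi` norm on `Fin d → ℝ`
is the sup norm). -/
noncomputable def normInf {d : ℕ} (v : Fin d → ℝ) : ℝ := ‖v‖

/-- The spectral (operator ℓ²→ℓ²) norm of a matrix `W ∈ ℝ^{d×c}`. -/
noncomputable def specNorm {d c : ℕ} (W : Matrix (Fin d) (Fin c) ℝ) : ℝ :=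
  ‖LinearMap.toContinuousLinearMap (Matrix.toEuclideanLin W)‖

lemma norm2_eq {d : ℕ} (v : Fin d → ℝ) : norm2 v = ‖WithLp.toLp 2 v‖ := by
  simp [norm2, EuclideanSpace.norm_eq]

open scoped Matrix.Norms.L2Operator in
lemma norm2_mulVec_le {d c : ℕ} (W : Matrix (Fin d) (Fin c) ℝ) (v : Fin d → ℝ) :
    norm2 ((Matrix.transpose W).mulVec v) ≤ specNorm W * norm2 v := by
  rw [norm2_eq, norm2_eq]
  have h1 := Matrix.l2_opNorm_mulVec (Matrix.conjTranspose W) (WithLp.toLp 2 v)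
  rw [Matrix.l2_opNorm_conjTranspose] at h1
  have h2 : ‖W‖ = specNorm W := by
    rw [Matrix.l2_opNorm_def]; rfl
  rw [h2, Matrix.conjTranspose_eq_transpose_of_trivial] at h1
  exact h1

lemma norm2_le_sqrt {d : ℕ} (v : Fin d → ℝ) (r : ℝ) (hr : 0 ≤ r) (hv : ∀ k, |v k| ≤ r) :
    norm2 v ≤ Real.sqrt d * r := by
  unfold norm2
  apply Real.sqrt_le_iff.mpr
  refine ⟨by positivity, ?_⟩
  rw [mul_pow, Real.sq_sqrt (by positivity)]
  calc ∑ i, v i ^ 2 ≤ ∑ i : Fin d, r ^ 2 :=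
        Finset.sum_le_sum fun i _ => sq_le_sq' (abs_le.mp (hv i)).1 (abs_le.mp (hv i)).2
    _ = _ := by simp

lemma mean_bound {n : ℕ} (A : Matrix (Fin n) (Fin n) ℝ)
    (hA0 : ∀ i j, 0 ≤ A i j) (hA1 : ∀ i, ∑ j, A i j = 1)
    (V S : Finset (Fin n)) (hS : S.Nonempty) (y : Fin n → ℝ) (m m' r : ℝ)
    (h1 : ∀ u ∈ V, |y u - m| ≤ r) (h2 : ∀ u ∈ Vᶜ, |y u - m'| ≤ r) (b : ℝ)
    (hb : b = (S.card : ℝ)⁻¹ * ∑ i ∈ S, ∑ j ∈ V, A i j) :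
    |(S.card : ℝ)⁻¹ * ∑ v ∈ S, ∑ u, A v u * y u - (b * m + (1 - b) * m')| ≤ r := by
  have hc : (0 : ℝ) < S.card := by exact_mod_cast hS.card_pos
  have key : ∀ v, |∑ u, A v u * y u - ((∑ j ∈ V, A v j) * m + (1 - ∑ j ∈ V, A v j) * m')| ≤ r := by
    intro v
    have e1 : 1 - ∑ j ∈ V, A v j = ∑ j ∈ Vᶜ, A v j := by
      rw [← hA1 v, ← Finset.sum_add_sum_compl V]; ring
    have e2 : ∑ u, A v u * y u - ((∑ j ∈ V, A v j) * m + (∑ j ∈ Vᶜ, A v j) * m')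
        = ∑ u ∈ V, A v u * (y u - m) + ∑ u ∈ Vᶜ, A v u * (y u - m') := by
      rw [← Finset.sum_add_sum_compl V]
      simp only [mul_sub, Finset.sum_sub_distrib, Finset.sum_mul]
      ring
    rw [e1, e2]
    have b1 : |∑ u ∈ V, A v u * (y u - m)| ≤ ∑ u ∈ V, A v u * r :=
      (Finset.abs_sum_le_sum_abs _ _).trans (Finset.sum_le_sum fun u hu => by
        rw [abs_mul, abs_of_nonneg (hA0 v u)]
        exact mul_le_mul_of_nonneg_left (h1 u hu) (hA0 v u))
    have b2 : |∑ u ∈ Vᶜ, A v u * (y u - m')| ≤ ∑ u ∈ Vᶜ, A v u * r :=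
      (Finset.abs_sum_le_sum_abs _ _).trans (Finset.sum_le_sum fun u hu => by
        rw [abs_mul, abs_of_nonneg (hA0 v u)]
        exact mul_le_mul_of_nonneg_left (h2 u hu) (hA0 v u))
    have b3 : ∑ u ∈ V, A v u * r + ∑ u ∈ Vᶜ, A v u * r = r := by
      rw [Finset.sum_add_sum_compl, ← Finset.sum_mul, hA1, one_mul]
    exact (abs_add_le _ _).trans (by linarith)
  have e : (S.card : ℝ)⁻¹ * ∑ v ∈ S, ∑ u, A v u * y u - (b * m + (1 - b) * m')
      = (S.card : ℝ)⁻¹ * ∑ v ∈ S,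
        (∑ u, A v u * y u - ((∑ j ∈ V, A v j) * m + (1 - ∑ j ∈ V, A v j) * m')) := by
    simp only [Finset.sum_sub_distrib, Finset.sum_add_distrib, ← Finset.sum_mul, hb,
      Finset.sum_const, nsmul_eq_mul]
    field_simp
  rw [e, abs_mul, abs_of_pos (inv_pos.mpr hc), inv_mul_le_iff₀ hc]
  refine (Finset.abs_sum_le_sum_abs _ _).trans ((Finset.sum_le_sum fun v _ => key v).trans ?_)
  simp

/-- Consequence of Theorem 1 of FairSample: if the graph structure is balanced,
i.e. `β[a,a] = β[≠a,a]` for every sensitive value `a`, then the demographic parity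
regularizer is bounded by `2√d·‖W‖₂·Σ_a δ_a`. -/
theorem stmt7 (n d c : ℕ) (x : Fin n → Fin d → ℝ)
    (α : Type) [Fintype α] [DecidableEq α] (s : Fin n → α)
    (V : α → Finset (Fin n)) (hV : ∀ a, V a = Finset.univ.filter fun v => s v = a)
    (hne : ∀ a, (V a).Nonempty) (hnec : ∀ a, (V a)ᶜ.Nonempty)
    (A : Matrix (Fin n) (Fin n) ℝ)
    (hA0 : ∀ i j, 0 ≤ A i j) (hA1 : ∀ i, ∑ j, A i j = 1)
    (W : Matrix (Fin d) (Fin c) ℝ)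
    (h : Fin n → Fin d → ℝ) (hh : ∀ v, h v = ∑ u, A v u • x u)
    (p : Fin n → Fin c → ℝ) (hp : ∀ v, p v = (Matrix.transpose W).mulVec (h v))
    (μ μ' : α → Fin d → ℝ)
    (hμ : ∀ a, μ a = ((V a).card : ℝ)⁻¹ • ∑ v ∈ V a, x v)
    (hμ' : ∀ a, μ' a = (((V a)ᶜ).card : ℝ)⁻¹ • ∑ v ∈ (V a)ᶜ, x v)
    (β β' : α → ℝ)
    (hβ : ∀ a, β a = ((V a).card : ℝ)⁻¹ * ∑ i ∈ V a, ∑ j ∈ V a, A i j)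
    (hβ' : ∀ a, β' a = (((V a)ᶜ).card : ℝ)⁻¹ * ∑ i ∈ (V a)ᶜ, ∑ j ∈ V a, A i j)
    (hbal : ∀ a, β a = β' a)
    (δ : α → ℝ)
    (hδ : ∀ a, δ a = max ((V a).sup' (hne a) fun v => normInf (x v - μ a))
                         (((V a)ᶜ).sup' (hnec a) fun v => normInf (x v - μ' a))) :
    ∑ a : α, norm2 (((V a).card : ℝ)⁻¹ • ∑ v ∈ V a, p v
        - (((V a)ᶜ).card : ℝ)⁻¹ • ∑ v ∈ (V a)ᶜ, p v)
      ≤ 2 * Real.sqrt d * specNorm W * ∑ a : α, δ a := by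
  rw [Finset.mul_sum]
  refine Finset.sum_le_sum fun a _ => ?_
  have hd1 : ∀ u ∈ V a, ∀ k, |x u k - μ a k| ≤ δ a := by
    intro u hu k
    have t1 := norm_le_pi_norm (x u - μ a) k
    have t2 := Finset.le_sup' (fun v => normInf (x v - μ a)) hu
    rw [hδ a]
    exact t1.trans (t2.trans (le_max_left _ _))
  have hd2 : ∀ u ∈ (V a)ᶜ, ∀ k, |x u k - μ' a k| ≤ δ a := by
    intro u hu k
    have t1 := norm_le_pi_norm (x u - μ' a) k
    have t2 := Finset.le_sup' (fun v => normInf (x v - μ' a)) hu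
    rw [hδ a]
    exact t1.trans (t2.trans (le_max_right _ _))
  have hd0 : 0 ≤ δ a := by
    obtain ⟨u, hu⟩ := hne a
    rw [hδ a]
    exact (norm_nonneg (x u - μ a)).trans
      ((Finset.le_sup' (fun v => normInf (x v - μ a)) hu).trans (le_max_left _ _))
  have ep : ((V a).card : ℝ)⁻¹ • ∑ v ∈ V a, p v - (((V a)ᶜ).card : ℝ)⁻¹ • ∑ v ∈ (V a)ᶜ, p v
      = (Matrix.transpose W).mulVec (((V a).card : ℝ)⁻¹ • ∑ v ∈ V a, h v
        - (((V a)ᶜ).card : ℝ)⁻¹ • ∑ v ∈ (V a)ᶜ, h v) := by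
    simp only [hp, Matrix.mulVec_sub, Matrix.mulVec_smul, Matrix.mulVec_sum]
  rw [ep]
  refine (norm2_mulVec_le W _).trans ?_
  have hs : 0 ≤ specNorm W := norm_nonneg _
  have hm := norm2_le_sqrt (((V a).card : ℝ)⁻¹ • ∑ v ∈ V a, h v
        - (((V a)ᶜ).card : ℝ)⁻¹ • ∑ v ∈ (V a)ᶜ, h v) (2 * δ a) (by linarith) (by
    intro k
    have m1 := mean_bound A hA0 hA1 (V a) (V a) (hne a) (fun u => x u k) (μ a k) (μ' a k) (δ a)
      (fun u hu => hd1 u hu k) (fun u hu => hd2 u hu k) (β a) (hβ a)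
    have m2 := mean_bound A hA0 hA1 (V a) (V a)ᶜ (hnec a) (fun u => x u k) (μ a k) (μ' a k) (δ a)
      (fun u hu => hd1 u hu k) (fun u hu => hd2 u hu k) (β a) ((hbal a).trans (hβ' a))
    simp only [hh, Pi.sub_apply, Pi.smul_apply, Finset.sum_apply, smul_eq_mul]
    rw [abs_le] at *
    constructor <;> linarith [m1.1, m1.2, m2.1, m2.2])
  calc _ ≤ specNorm W * (Real.sqrt d * (2 * δ a)) := mul_le_mul_of_nonneg_left hm hs
    _ = _ := by ring
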